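/- Let $S_d$ be the symmetric group on $\{1,\dots,d\}$, and for a transposition $\tau=(a\ b)\in S_d$ with $a<b$ put $\mathrm{top}(\tau)=b$. Let $\mu_1,\mu_2,\nu_1,\nu_2$ be positive integers with $\mu_1+\mu_2=\nu_1+\nu_2=d$, and suppose $\mu_1<\nu_1$, $\nu_2<\mu_1$, $\mu_2<\nu_1$, $\nu_2<\mu_2$. Let $\sigma_{(\mu_1,\mu_2)}=(1\ \cdots\ \mu_1)(\mu_1+1\ \cdots\ \mu_1+\mu_2)\in S_d$. Let $M_{2,0,0;(\mu_1,\mu_2),(\nu_1,\nu_2)}$ be the number of tuples $(\tau_1,\tau_2,\sigma_2,(B_1,B_2))$ such that $\tau_1,\tau_2\in S_d$ are transpositions with $\mathrm{top}(\tau_1)\le\mathrm{top}(\tau_2)$ (the monotone condition), $\sigma_2\in S_d$ satisfies $\sigma_2\,\tau_2\,\tau_1\,\sigma_{(\mu_1,\mu_2)}=\mathrm{id}$, the subgroup generated by $\sigma_{(\mu_1,\mu_2)},\tau_1,\tau_2,\sigma_2$ acts transitively on $\{1,\dots,d\}$, and $(B_1,B_2)$ is an ordered list of the orbits of $\sigma_2$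 on $\{1,\dots,d\}$ (each orbit listed exactly once) with $|B_1|=\nu_1$, $|B_2|=\nu_2$. Then $$M_{2,0,0;(\mu_1,\mu_2),(\nu_1,\nu_2)}=\mu_1\mu_2(\nu_1+1).$$ -/

import Mathlib

/-- The larger moved point of a transposition, as a natural number (the points `1, …, d` are
represented by `Fin d`, so that all values are shifted by one). -/
def permTop {d : ℕ} (τ : Equiv.Perm (Fin d)) : ℕ := τ.support.sup Fin.val

/-- The `(p,q)`-monotonicity condition on a tuple `(τ₁,…,τ_b)` of transpositions
(indexed by `Fin b`, with index `i` corresponding to `τ_{i+1}`):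
`top τ_k ≤ top τ_{k+1}` for `1 ≤ k ≤ p-1` and `top τ_k < top τ_{k+1}` for `p ≤ k ≤ p+q-1`. -/
def MonCond {d b : ℕ} (p q : ℕ) (τ : Fin b → Equiv.Perm (Fin d)) : Prop :=
  ∀ i j : Fin b, (j : ℕ) = (i : ℕ) + 1 →
    ((i : ℕ) + 1 < p → permTop (τ i) ≤ permTop (τ j)) ∧
    (p ≤ (i : ℕ) + 1 → (i : ℕ) + 1 < p + q → permTop (τ i) < permTop (τ j))

/-- The permutation `σ_μ = (1 … μ₁)(μ₁+1 … μ₁+μ₂)⋯` whose cycles are the consecutive blocks of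
lengths `μ₁, …, μ_m`: the point number `k` of block `i` is `μ₁ + ⋯ + μ_{i-1} + k`, and each block
is rotated by `k ↦ k + 1`. -/
def blockPerm {m : ℕ} (μ : Fin m → ℕ) : Equiv.Perm (Fin (∑ i, μ i)) :=
  finSigmaFinEquiv.permCongr (Equiv.sigmaCongrRight fun i => finRotate (μ i))

/-- `B` is an ordered list of the orbits of `σ` on `{1,…,d}` with `|B_j| = ν_j`:
each `B_j` is an orbit (i.e. a cycle, possibly a fixed point), the `B_j` are
pairwise distinct, every point lies in some `B_j`, and `B_j` has `ν_j` elements. -/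
def IsOrbitListing {d n : ℕ} (σ : Equiv.Perm (Fin d)) (ν : Fin n → ℕ)
    (B : Fin n → Set (Fin d)) : Prop :=
  (∀ j, ∃ x : Fin d, B j = {y | σ.SameCycle x y}) ∧
  Function.Injective B ∧
  (∀ x : Fin d, ∃ j, x ∈ B j) ∧
  (∀ j, (B j).ncard = ν j)

/-- `M_{p,q,r;μ,ν}`, with `d = μ₁ + ⋯ + μ_m` and `b = p + q + r`: the number of tuples
`(τ₁,…,τ_b, σ₂, (B₁,…,B_n))` where each `τᵢ` is a transposition, `(τ₁,…,τ_b)` satisfies the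
`(p,q)`-monotonicity condition, `σ₂·τ_b⋯τ₁·σ_μ = id`, the subgroup generated by
`σ_μ, τ₁,…,τ_b, σ₂` acts transitively on `{1,…,d}`, and `(B₁,…,B_n)` is an ordered list of the
orbits of `σ₂` with `|B_j| = ν_j`. -/
noncomputable def Mcount {m n : ℕ} (p q r : ℕ) (μ : Fin m → ℕ) (ν : Fin n → ℕ) : ℕ :=
  Nat.card { t : (Fin (p + q + r) → Equiv.Perm (Fin (∑ i, μ i))) ×
      Equiv.Perm (Fin (∑ i, μ i)) × (Fin n → Set (Fin (∑ i, μ i))) //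
    (∀ i, (t.1 i).IsSwap) ∧ MonCond p q t.1 ∧
    t.2.1 * (List.ofFn t.1).reverse.prod * blockPerm μ = 1 ∧
    (∀ x y : Fin (∑ i, μ i), ∃ g ∈ Subgroup.closure
        ({blockPerm μ, t.2.1} ∪ Set.range t.1 : Set (Equiv.Perm (Fin (∑ i, μ i)))), g x = y) ∧
    IsOrbitListing t.2.1 ν t.2.2 }

open Function hiding swap
open Equiv

set_option linter.unusedSectionVars false

section Period

variable {α : Type*} [Finite α]

theorem perm_mem_periodicPts (π : Perm α) (x : α) : x ∈ periodicPts π :=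
  π.injective.mem_periodicPts x

theorem perm_minimalPeriod_pos (π : Perm α) (x : α) : 0 < minimalPeriod π x :=
  minimalPeriod_pos_of_mem_periodicPts (perm_mem_periodicPts π x)

theorem sameCycle_iterate (π : Perm α) (x : α) (i : ℕ) : π.SameCycle x (π^[i] x) :=
  ⟨i, by rw [zpow_natCast, Perm.iterate_eq_pow]⟩

theorem SameCycle.exists_iterate_eq {π : Perm α} {x y : α} (h : π.SameCycle x y) :
    ∃ i < minimalPeriod π x, π^[i] x = y := by
  obtain ⟨i, -, hi⟩ := h.exists_pow_eq'
  refine ⟨i % minimalPeriod π x, Nat.mod_lt _ (perm_minimalPeriod_pos π x), ?_⟩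
  rw [iterate_mod_minimalPeriod_eq, Perm.iterate_eq_pow, hi]

theorem SameCycle.minimalPeriod_eq {π : Perm α} {x y : α} (h : π.SameCycle x y) :
    minimalPeriod π x = minimalPeriod π y := by
  obtain ⟨i, -, rfl⟩ := SameCycle.exists_iterate_eq h
  exact (minimalPeriod_apply_iterate (perm_mem_periodicPts π x) i).symm

theorem ncard_sameCycle (π : Perm α) (x : α) :
    {y | π.SameCycle x y}.ncard = minimalPeriod π x := by
  have : {y | π.SameCycle x y} = (π^[·] x) '' Set.Iio (minimalPeriod π x) := by
    ext y
    constructor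
    · intro h
      obtain ⟨i, hi, rfl⟩ := SameCycle.exists_iterate_eq h
      exact ⟨i, hi, rfl⟩
    · rintro ⟨i, -, rfl⟩
      exact sameCycle_iterate π x i
  rw [this, Set.InjOn.ncard_image iterate_injOn_Iio_minimalPeriod, ← Finset.coe_Iio,
    Set.ncard_coe_finset, Nat.card_Iio]

theorem minimalPeriod_inv (π : Perm α) (x : α) :
    minimalPeriod (π⁻¹ : Perm α) x = minimalPeriod π x := by
  rw [← ncard_sameCycle, ← ncard_sameCycle]
  simp only [Perm.sameCycle_inv]

theorem minimalPeriod_eq_of_forall_ne {f : α → α} {x : α} {k : ℕ} (hk : 0 < k)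
    (h : f^[k] x = x) (hlt : ∀ i, 0 < i → i < k → f^[i] x ≠ x) : minimalPeriod f x = k := by
  have h1 : IsPeriodicPt f k x := h
  refine le_antisymm (h1.minimalPeriod_le hk) (not_lt.1 fun hl => ?_)
  exact hlt _ (h1.minimalPeriod_pos hk) hl iterate_minimalPeriod

theorem iterate_ne_self_of_lt {f : α → α} {x : α} {i : ℕ} (hi : 0 < i)
    (hlt : i < minimalPeriod f x) : f^[i] x ≠ x := fun h =>
  absurd (IsPeriodicPt.minimalPeriod_le hi h) (not_le.2 hlt)

variable [DecidableEq α]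

theorem swap_mul_iterate_of_avoid {π : Perm α} {x y z : α} {k : ℕ}
    (h : ∀ i, 0 < i → i < k → π^[i] z ≠ x ∧ π^[i] z ≠ y) {i : ℕ} (hi : i < k) :
    (swap x y * π : Perm α)^[i] z = π^[i] z := by
  induction i with
  | zero => rfl
  | succ j ih =>
    rw [iterate_succ_apply', ih (by omega), Perm.mul_apply, ← iterate_succ_apply' π]
    obtain ⟨h1, h2⟩ := h (j + 1) (by omega) hi
    exact swap_apply_of_ne_of_ne h1 h2

theorem swap_mul_iterate_of_avoid_end {π : Perm α} {x y z : α} {k : ℕ} (hk : 0 < k)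
    (h : ∀ i, 0 < i → i < k → π^[i] z ≠ x ∧ π^[i] z ≠ y) :
    (swap x y * π : Perm α)^[k] z = swap x y (π^[k] z) := by
  obtain ⟨j, rfl⟩ : ∃ j, k = j + 1 := ⟨k - 1, by omega⟩
  rw [iterate_succ_apply', swap_mul_iterate_of_avoid h (by omega), Perm.mul_apply,
    ← iterate_succ_apply' π]

/-- Away from the cycles of `x` and `y`, multiplying by `swap x y` changes no period. -/
theorem minimalPeriod_swap_mul_of_not_sameCycle {π : Perm α} {x y z : α}
    (hx : ¬ π.SameCycle x z) (hy : ¬ π.SameCycle y z) :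
    minimalPeriod (swap x y * π : Perm α) z = minimalPeriod π z := by
  have key : ∀ i, (swap x y * π : Perm α)^[i] z = π^[i] z := fun i =>
    swap_mul_iterate_of_avoid (k := i + 1) (fun j _ _ =>
      ⟨fun (h : π^[j] z = x) => hx (h ▸ sameCycle_iterate π z j : π.SameCycle z x).symm,
        fun (h : π^[j] z = y) => hy (h ▸ sameCycle_iterate π z j : π.SameCycle z y).symm⟩)
      (by omega)
  rw [minimalPeriod_eq_minimalPeriod_iff]
  intro i
  simp only [IsPeriodicPt, IsFixedPt, key]

theorem iterate_ne_of_cut {π : Perm α} {x y : α} {k : ℕ} (hk : k < minimalPeriod π x)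
    (hy : π^[k] x = y) (i : ℕ) (hi : 0 < i) (hik : i < k) : π^[i] x ≠ x ∧ π^[i] x ≠ y := by
  refine ⟨iterate_ne_self_of_lt hi (hik.trans hk), fun h => ?_⟩
  rw [← hy, iterate_eq_iterate_iff_of_lt_minimalPeriod (hik.trans hk) hk] at h
  omega

/-- If `x` and `y` lie on one cycle of `π`, at distance `k`, then `swap x y` cuts off a cycle
`x, π x, …, π^(k-1) x`. -/
theorem minimalPeriod_swap_mul_cut_left {π : Perm α} {x y : α} {k : ℕ} (hk0 : 0 < k)
    (hk : k < minimalPeriod π x) (hy : π^[k] x = y) :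
    minimalPeriod (swap x y * π : Perm α) x = k := by
  have h := iterate_ne_of_cut hk hy
  refine minimalPeriod_eq_of_forall_ne hk0 ?_ fun i hi hik => ?_
  · rw [swap_mul_iterate_of_avoid_end hk0 h, hy, swap_apply_right]
  · rw [swap_mul_iterate_of_avoid h hik]
    exact (h i hi hik).1

theorem iterate_sub_of_iterate {π : Perm α} {x y : α} {k : ℕ}
    (hk : k < minimalPeriod π x) (hy : π^[k] x = y) : π^[minimalPeriod π x - k] y = x := by
  rw [← hy, ← iterate_add_apply, Nat.sub_add_cancel hk.le, iterate_minimalPeriod]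

theorem minimalPeriod_swap_mul_cut_right {π : Perm α} {x y : α} {k : ℕ} (hk0 : 0 < k)
    (hk : k < minimalPeriod π x) (hy : π^[k] x = y) :
    minimalPeriod (swap x y * π : Perm α) y = minimalPeriod π x - k := by
  have hp : minimalPeriod π y = minimalPeriod π x :=
    (SameCycle.minimalPeriod_eq (hy ▸ sameCycle_iterate π x k)).symm
  rw [swap_comm]
  exact minimalPeriod_swap_mul_cut_left (by omega) (by omega) (iterate_sub_of_iterate hk hy)

theorem sameCycle_swap_mul_cut {π : Perm α} {x y : α} {k : ℕ} (hk : k < minimalPeriod π x)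
    (hy : π^[k] x = y) {i : ℕ} (hi : i < k) :
    (swap x y * π : Perm α).SameCycle x (π^[i] x) := by
  rw [← swap_mul_iterate_of_avoid (iterate_ne_of_cut hk hy) hi]
  exact sameCycle_iterate _ _ _

/-- Every point of the cycle that `swap x y` cuts ends up with `x` or with `y`. -/
theorem sameCycle_swap_mul_cut_or {π : Perm α} {x y z : α} (hxy : x ≠ y)
    (h : π.SameCycle x y) (hz : π.SameCycle x z) :
    (swap x y * π : Perm α).SameCycle x z ∨ (swap x y * π : Perm α).SameCycle y z := by
  obtain ⟨k, hk, hy⟩ := SameCycle.exists_iterate_eq h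
  obtain ⟨i, hi, rfl⟩ := SameCycle.exists_iterate_eq hz
  have hk0 : 0 < k := Nat.pos_of_ne_zero fun h0 => hxy (by subst h0; exact hy)
  rcases lt_or_ge i k with hik | hik
  · exact Or.inl (sameCycle_swap_mul_cut hk hy hik)
  · right
    have hp : minimalPeriod π y = minimalPeriod π x :=
      (SameCycle.minimalPeriod_eq (hy ▸ sameCycle_iterate π x k)).symm
    have := sameCycle_swap_mul_cut (i := i - k) (by omega) (iterate_sub_of_iterate hk hy) (by omega)
    rw [swap_comm] at this
    rwa [← hy, ← iterate_add_apply, Nat.sub_add_cancel hik, hy] at this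

theorem iterate_ne_of_join {π : Perm α} {x y : α} (h : ¬ π.SameCycle x y)
    (i : ℕ) (hi : 0 < i) (hik : i < minimalPeriod π x) : π^[i] x ≠ x ∧ π^[i] x ≠ y :=
  ⟨iterate_ne_self_of_lt hi hik, fun e => h (e ▸ sameCycle_iterate π x i)⟩

theorem sameCycle_swap_mul_join {π : Perm α} {x y z : α} (h : ¬ π.SameCycle x y)
    (hz : π.SameCycle x z) : (swap x y * π : Perm α).SameCycle x z := by
  obtain ⟨i, hi, rfl⟩ := SameCycle.exists_iterate_eq hz
  rw [← swap_mul_iterate_of_avoid (iterate_ne_of_join h) hi]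
  exact sameCycle_iterate _ _ _

theorem swap_mul_iterate_join {π : Perm α} {x y : α} (h : ¬ π.SameCycle x y) :
    (swap x y * π : Perm α)^[minimalPeriod π x] x = y := by
  rw [swap_mul_iterate_of_avoid_end (perm_minimalPeriod_pos π x) (iterate_ne_of_join h),
    iterate_minimalPeriod, swap_apply_left]

/-- If `x` and `y` lie on different cycles of `π`, then `swap x y` joins these. -/
theorem minimalPeriod_swap_mul_join {π : Perm α} {x y : α} (h : ¬ π.SameCycle x y) :
    minimalPeriod (swap x y * π : Perm α) x = minimalPeriod π x + minimalPeriod π y := by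
  have h' : ¬ π.SameCycle y x := fun e => h e.symm
  have hx := perm_minimalPeriod_pos π x
  have hy := perm_minimalPeriod_pos π y
  refine minimalPeriod_eq_of_forall_ne (by omega) ?_ fun i hi hik => ?_
  · rw [add_comm, iterate_add_apply, swap_mul_iterate_join h, swap_comm, swap_mul_iterate_join h']
  · rcases lt_or_ge i (minimalPeriod π x) with hlt | hge
    · rw [swap_mul_iterate_of_avoid (iterate_ne_of_join h) hlt]
      exact (iterate_ne_of_join h i hi hlt).1
    · obtain ⟨j, rfl⟩ := Nat.exists_eq_add_of_le' hge
      rw [iterate_add_apply, swap_mul_iterate_join h, swap_comm,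
        swap_mul_iterate_of_avoid (iterate_ne_of_join h') (by omega)]
      intro e
      exact h' (e ▸ sameCycle_iterate π y j)

theorem minimalPeriod_swap_mul_join_of_sameCycle {π : Perm α} {x y z : α}
    (h : ¬ π.SameCycle x y) (hz : π.SameCycle x z ∨ π.SameCycle y z) :
    minimalPeriod (swap x y * π : Perm α) z = minimalPeriod π x + minimalPeriod π y := by
  rcases hz with hz | hz
  · rw [← SameCycle.minimalPeriod_eq (sameCycle_swap_mul_join h hz), minimalPeriod_swap_mul_join h]
  · have h' : ¬ π.SameCycle y x := fun e => h e.symm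
    rw [swap_comm, ← SameCycle.minimalPeriod_eq (sameCycle_swap_mul_join h' hz),
      minimalPeriod_swap_mul_join h', add_comm]

/-- If all periods of `π` are less than `k`, then `swap x y * π` has a cycle of length `k` if and
only if `swap x y` joins two cycles of total length `k`. -/
theorem exists_minimalPeriod_swap_mul_iff {π : Perm α} {x y : α} {k : ℕ} (hxy : x ≠ y)
    (hlt : ∀ z, minimalPeriod π z < k) :
    (∃ z, minimalPeriod (swap x y * π : Perm α) z = k) ↔
      ¬ π.SameCycle x y ∧ minimalPeriod π x + minimalPeriod π y = k := by
  constructor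
  · rintro ⟨z, hz⟩
    by_cases hs : π.SameCycle x y
    · exfalso
      by_cases hxz : π.SameCycle x z
      · obtain ⟨j, hj, hy⟩ := SameCycle.exists_iterate_eq hs
        have hj0 : 0 < j := Nat.pos_of_ne_zero fun h0 => hxy (by subst h0; exact hy)
        have hx := hlt x
        rcases sameCycle_swap_mul_cut_or hxy hs hxz with h | h
        · rw [← SameCycle.minimalPeriod_eq h, minimalPeriod_swap_mul_cut_left hj0 hj hy] at hz
          omega
        · rw [← SameCycle.minimalPeriod_eq h, minimalPeriod_swap_mul_cut_right hj0 hj hy] at hz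
          omega
      · rw [minimalPeriod_swap_mul_of_not_sameCycle hxz fun h => hxz (hs.trans h)] at hz
        exact (hlt z).ne hz
    · refine ⟨hs, ?_⟩
      by_cases hz' : π.SameCycle x z ∨ π.SameCycle y z
      · rw [← hz, minimalPeriod_swap_mul_join_of_sameCycle hs hz']
      · rw [not_or] at hz'
        rw [minimalPeriod_swap_mul_of_not_sameCycle hz'.1 hz'.2] at hz
        exact absurd hz (hlt z).ne
  · rintro ⟨h, hk⟩
    exact ⟨x, (minimalPeriod_swap_mul_join h).trans hk⟩

/-- If `π` is a single cycle, then `swap x y * π` has cycles of two different lengths `k` and `l`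
that exhaust the points if and only if `x` is `k` or `l` steps from `y`. -/
theorem exists_minimalPeriod_swap_mul_full_cycle_iff {π : Perm α} {x y : α} {k l : ℕ}
    (hxy : x ≠ y) (hk : 0 < k) (hl : 0 < l)
    (hfull : ∀ z, π.SameCycle y z) (hlen : minimalPeriod π y = k + l) :
    ((∃ z, minimalPeriod (swap x y * π : Perm α) z = k) ∧
      (∃ z, minimalPeriod (swap x y * π : Perm α) z = l)) ↔ x = π^[k] y ∨ x = π^[l] y := by
  rw [swap_comm]
  constructor
  · rintro ⟨⟨z, hz⟩, -⟩
    obtain ⟨j, hj, hx⟩ := SameCycle.exists_iterate_eq (hfull x)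
    have hj0 : 0 < j := Nat.pos_of_ne_zero fun h0 => hxy (by subst h0; exact hx.symm)
    rcases sameCycle_swap_mul_cut_or hxy.symm (hfull x) (hfull z) with h | h
    · rw [← SameCycle.minimalPeriod_eq h, minimalPeriod_swap_mul_cut_left hj0 hj hx] at hz
      exact Or.inl (by rw [← hz, hx])
    · rw [← SameCycle.minimalPeriod_eq h, minimalPeriod_swap_mul_cut_right hj0 hj hx] at hz
      obtain rfl : j = l := by omega
      exact Or.inr hx.symm
  · rintro (h | h)
    · refine ⟨⟨y, minimalPeriod_swap_mul_cut_left hk (by omega) h.symm⟩, ⟨x, ?_⟩⟩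
      rw [minimalPeriod_swap_mul_cut_right hk (by omega) h.symm]
      omega
    · refine ⟨⟨x, ?_⟩, ⟨y, minimalPeriod_swap_mul_cut_left hl (by omega) h.symm⟩⟩
      rw [minimalPeriod_swap_mul_cut_right hl (by omega) h.symm]
      omega

end Period

/-- `σ` rotates the interval `[l, l + k)`. -/
def RotatesInterval {d : ℕ} (σ : Perm (Fin d)) (l k : ℕ) : Prop :=
  ∀ z : Fin d, l ≤ z → (z : ℕ) < l + k → (σ z : ℕ) = if (z : ℕ) + 1 = l + k then l else z + 1

namespace RotatesInterval

variable {d l k : ℕ} {σ : Perm (Fin d)}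

theorem mapsTo (h : RotatesInterval σ l k) {z : Fin d} (h1 : l ≤ z) (h2 : (z : ℕ) < l + k) :
    l ≤ σ z ∧ (σ z : ℕ) < l + k := by
  rw [h z h1 h2]
  split_ifs <;> omega

theorem iterate_mapsTo (h : RotatesInterval σ l k) {z : Fin d} (h1 : l ≤ z)
    (h2 : (z : ℕ) < l + k) (i : ℕ) : l ≤ σ^[i] z ∧ (σ^[i] z : ℕ) < l + k := by
  induction i with
  | zero => exact ⟨h1, h2⟩
  | succ i ih =>
    rw [iterate_succ_apply']
    exact h.mapsTo ih.1 ih.2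

theorem iterate_val (h : RotatesInterval σ l k) {z : Fin d} (h1 : l ≤ z) {i : ℕ}
    (h2 : (z : ℕ) + i < l + k) : (σ^[i] z : ℕ) = z + i := by
  induction i with
  | zero => rfl
  | succ i ih =>
    have hi := ih (by omega)
    rw [iterate_succ_apply', h _ (by omega) (by omega), if_neg (by omega), hi]
    omega

theorem sameCycle_of_le (h : RotatesInterval σ l k) {z w : Fin d} (h1 : l ≤ z) (hzw : z ≤ w)
    (h2 : (w : ℕ) < l + k) : σ.SameCycle z w := by
  have hzw' : (z : ℕ) ≤ w := hzw
  have : σ^[(w : ℕ) - z] z = w := by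
    apply Fin.ext
    rw [h.iterate_val h1 (by omega)]
    omega
  rw [← this]
  exact sameCycle_iterate _ _ _

theorem sameCycle (h : RotatesInterval σ l k) {z w : Fin d} (hz1 : l ≤ z)
    (hz2 : (z : ℕ) < l + k) (hw1 : l ≤ w) (hw2 : (w : ℕ) < l + k) : σ.SameCycle z w := by
  rcases le_total z w with hl | hl
  · exact h.sameCycle_of_le hz1 hl hw2
  · exact (h.sameCycle_of_le hw1 hl hz2).symm

theorem mem_of_sameCycle (h : RotatesInterval σ l k) {z w : Fin d} (hz1 : l ≤ z)
    (hz2 : (z : ℕ) < l + k) (hs : σ.SameCycle z w) : l ≤ w ∧ (w : ℕ) < l + k := by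
  obtain ⟨i, -, rfl⟩ := SameCycle.exists_iterate_eq hs
  exact h.iterate_mapsTo hz1 hz2 i

theorem minimalPeriod_eq (h : RotatesInterval σ l k) (hd : l + k ≤ d) {z : Fin d} (hz1 : l ≤ z)
    (hz2 : (z : ℕ) < l + k) : minimalPeriod σ z = k := by
  rw [← ncard_sameCycle]
  have : {y | σ.SameCycle z y} = ((Finset.Ico l (l + k)).attachFin
      (fun i hi => by rw [Finset.mem_Ico] at hi; omega) : Finset (Fin d)) := by
    ext y
    simp only [Set.mem_ofPred_eq, Finset.mem_coe, Finset.mem_attachFin, Finset.mem_Ico]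
    exact ⟨h.mem_of_sameCycle hz1 hz2, fun hy => h.sameCycle hz1 hz2 hy.1 hy.2⟩
  rw [this, Set.ncard_coe_finset, Finset.card_attachFin, Nat.card_Ico]
  omega

theorem swap_mul_inside (h : RotatesInterval σ l k) {a b : Fin d} (ha : l ≤ a) (hab : a < b)
    (hb : (b : ℕ) < l + k) : RotatesInterval (swap a b * σ) a (b - a) := by
  intro z hz1 hz2
  have hab' : (a : ℕ) < b := hab
  have hz := h z (by omega) (by omega)
  rw [if_neg (by omega)] at hz
  rw [Perm.mul_apply]
  split_ifs with hc
  · have : σ z = b := Fin.ext (by omega)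
    rw [this, swap_apply_right]
  · rw [swap_apply_of_ne_of_ne, hz]
    · intro e
      rw [e] at hz
      omega
    · intro e
      rw [e] at hz
      omega

theorem swap_mul_outside (h : RotatesInterval σ l k) {a b : Fin d}
    (ha : ¬ (l ≤ a ∧ (a : ℕ) < l + k)) (hb : ¬ (l ≤ b ∧ (b : ℕ) < l + k)) :
    RotatesInterval (swap a b * σ) l k := by
  intro z hz1 hz2
  rw [Perm.mul_apply, swap_apply_of_ne_of_ne, h z hz1 hz2]
  · rintro rfl
    exact ha (h.mapsTo hz1 hz2)
  · rintro rfl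
    exact hb (h.mapsTo hz1 hz2)

/-- The period of the points of a rotated interval that lie outside the part cut off by
`swap a b`. -/
theorem minimalPeriod_swap_mul (h : RotatesInterval σ l k) (hd : l + k ≤ d) {a b z : Fin d}
    (ha : l ≤ a) (hab : a < b) (hb : (b : ℕ) < l + k) (hz1 : l ≤ z) (hz2 : (z : ℕ) < l + k)
    (hz : ¬ (a ≤ z ∧ z < b)) :
    minimalPeriod (swap a b * σ : Perm (Fin d)) z = k - (b - a) := by
  have hab' : (a : ℕ) < b := hab
  have hp : minimalPeriod σ a = k := h.minimalPeriod_eq hd ha (by omega)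
  rcases sameCycle_swap_mul_cut_or hab.ne (h.sameCycle ha (by omega) (by omega) hb)
    (h.sameCycle ha (by omega) hz1 hz2) with hs | hs
  · have := (h.swap_mul_inside ha hab hb).mem_of_sameCycle le_rfl (by omega) hs
    refine absurd ⟨Fin.le_def.2 this.1, Fin.lt_def.2 ?_⟩ hz
    omega
  · have hit : σ^[(b : ℕ) - a] a = b := by
      apply Fin.ext
      rw [h.iterate_val ha (by omega)]
      omega
    rw [← SameCycle.minimalPeriod_eq hs,
      minimalPeriod_swap_mul_cut_right (by omega) (by omega) hit, hp]

end RotatesInterval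

/-- `π` has cycles of lengths `k` and `l`. -/
def HasCycleLengths {d : ℕ} (π : Perm (Fin d)) (k l : ℕ) : Prop :=
  (∃ z, minimalPeriod π z = k) ∧ (∃ z, minimalPeriod π z = l)

section Cases

variable {n m k l : ℕ} {σ : Perm (Fin (n + m))} {a b x y : Fin (n + m)}

/-- The first transposition cuts the first block. -/
theorem hasCycleLengths_iff_of_cut_left (h1 : RotatesInterval σ 0 n) (h2 : RotatesInterval σ n m)
    (hd : n + m = k + l) (hnk : n < k) (hmk : m < k)
    (hab : a < b) (hxy : x < y) (hb : (b : ℕ) < n) :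
    HasCycleLengths (swap x y * (swap a b * σ)) k l ↔
      n ≤ y ∧ (x : ℕ) < n ∧
        ((a ≤ x ∧ x < b) ∧ (b : ℕ) + l = a + n ∨ ¬ (a ≤ x ∧ x < b) ∧ (b : ℕ) = a + l) := by
  have hab' : (a : ℕ) < b := hab
  have hxy' : (x : ℕ) < y := hxy
  set c := swap a b * σ with hc
  have hI : RotatesInterval c a (b - a) := h1.swap_mul_inside (by omega) hab (by omega)
  have hK : RotatesInterval c n m := h2.swap_mul_outside (by omega) (by omega)
  have pI : ∀ z : Fin (n + m), a ≤ z ∧ z < b → minimalPeriod c z = b - a := fun z hz =>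
    hI.minimalPeriod_eq (by omega) hz.1 (by have : (z : ℕ) < b := hz.2; omega)
  have pJ : ∀ z : Fin (n + m), (z : ℕ) < n → ¬ (a ≤ z ∧ z < b) →
      minimalPeriod c z = n - (b - a) := fun z hz hz' =>
    h1.minimalPeriod_swap_mul (by omega) (by omega) hab (by omega) (by omega) (by omega) hz'
  have pK : ∀ z : Fin (n + m), n ≤ (z : ℕ) → minimalPeriod c z = m := fun z hz =>
    hK.minimalPeriod_eq le_rfl hz z.2
  have hlt : ∀ z, minimalPeriod c z < k := by
    intro z
    by_cases hz : a ≤ z ∧ z < b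
    · rw [pI z hz]; omega
    · rcases lt_or_ge (z : ℕ) n with hz' | hz'
      · rw [pJ z hz' hz]; omega
      · rw [pK z hz']; omega
  have hIb : ¬ (a ≤ b ∧ b < b) := fun e => lt_irrefl _ e.2
  rw [HasCycleLengths, exists_minimalPeriod_swap_mul_iff hxy.ne hlt]
  constructor
  · rintro ⟨⟨hs, hk⟩, -⟩
    have hxn : (x : ℕ) < n := by
      by_contra hx
      exact hs (hK.sameCycle (not_lt.1 hx) x.2 (by omega) y.2)
    by_cases hxI : a ≤ x ∧ x < b
    · rcases lt_or_ge (y : ℕ) n with hy | hy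
      · by_cases hyI : a ≤ y ∧ y < b
        · refine absurd (hI.sameCycle hxI.1 ?_ hyI.1 ?_) hs
          · have : (x : ℕ) < b := hxI.2
            omega
          · have : (y : ℕ) < b := hyI.2
            omega
        · rw [pI x hxI, pJ y hy hyI] at hk
          omega
      · rw [pI x hxI, pK y hy] at hk
        exact ⟨hy, hxn, Or.inl ⟨hxI, by omega⟩⟩
    · rcases lt_or_ge (y : ℕ) n with hy | hy
      · by_cases hyI : a ≤ y ∧ y < b
        · rw [pJ x hxn hxI, pI y hyI] at hk
          omega
        · exfalso
          refine hs ?_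
          have key : ∀ z : Fin (n + m), (z : ℕ) < n → ¬ (a ≤ z ∧ z < b) → c.SameCycle b z := by
            intro z hz hzI
            have ho := sameCycle_swap_mul_cut_or hab.ne
              (h1.sameCycle (z := a) (w := b) (by omega) (by omega) (by omega) (by omega))
              (h1.sameCycle (z := a) (w := z) (by omega) (by omega) (by omega) (by omega))
            refine ho.resolve_left fun hs' => hzI ?_
            have := hI.mem_of_sameCycle le_rfl (by omega) hs'
            exact ⟨this.1, Fin.lt_def.2 (by omega)⟩
          exact (key x hxn hxI).symm.trans (key y hy hyI)
      · rw [pJ x hxn hxI, pK y hy] at hk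
        exact ⟨hy, hxn, Or.inr ⟨hxI, by omega⟩⟩
  · rintro ⟨hy, hxn, hx⟩
    have hs : ¬ c.SameCycle x y := fun e => by
      have := hK.mem_of_sameCycle hy y.2 e.symm
      omega
    have hyz : ∀ z : Fin (n + m), (z : ℕ) < n → ¬ c.SameCycle y z := fun z hz e => by
      have := hK.mem_of_sameCycle hy y.2 e
      omega
    rcases hx with ⟨hxI, he⟩ | ⟨hxI, he⟩
    · refine ⟨⟨hs, by rw [pI x hxI, pK y hy]; omega⟩, b, ?_⟩
      have hxI' : (x : ℕ) < b := hxI.2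
      rw [minimalPeriod_swap_mul_of_not_sameCycle _ (hyz b hb), pJ b hb hIb]
      · omega
      · intro e
        have := hI.mem_of_sameCycle hxI.1 (by omega) e
        omega
    · refine ⟨⟨hs, by rw [pJ x hxn hxI, pK y hy]; omega⟩, a, ?_⟩
      rw [minimalPeriod_swap_mul_of_not_sameCycle _ (hyz a (by omega)), pI a ⟨le_rfl, hab⟩]
      · omega
      · intro e
        have := hI.mem_of_sameCycle le_rfl (by omega) e.symm
        exact hxI ⟨this.1, Fin.lt_def.2 (by omega)⟩

/-- The first transposition cuts the second block. -/
theorem hasCycleLengths_iff_of_cut_right (h1 : RotatesInterval σ 0 n)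
    (h2 : RotatesInterval σ n m) (hd : n + m = k + l) (hnk : n < k) (hmk : m < k)
    (hab : a < b) (hxy : x < y) (hby : b ≤ y) (ha : n ≤ a) :
    HasCycleLengths (swap x y * (swap a b * σ)) k l ↔ (x : ℕ) < n ∧ (b : ℕ) = a + l := by
  have hab' : (a : ℕ) < b := hab
  have hxy' : (x : ℕ) < y := hxy
  have hby' : (b : ℕ) ≤ y := hby
  set c := swap a b * σ with hc
  have hI : RotatesInterval c a (b - a) := h2.swap_mul_inside (by omega) hab (by omega)
  have hK : RotatesInterval c 0 n := h1.swap_mul_outside (by omega) (by omega)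
  have pI : ∀ z : Fin (n + m), a ≤ z ∧ z < b → minimalPeriod c z = b - a := fun z hz =>
    hI.minimalPeriod_eq (by omega) hz.1 (by have : (z : ℕ) < b := hz.2; omega)
  have pJ : ∀ z : Fin (n + m), n ≤ (z : ℕ) → ¬ (a ≤ z ∧ z < b) →
      minimalPeriod c z = m - (b - a) := fun z hz hz' =>
    h2.minimalPeriod_swap_mul le_rfl ha hab b.2 hz z.2 hz'
  have pK : ∀ z : Fin (n + m), (z : ℕ) < n → minimalPeriod c z = n := fun z hz =>
    hK.minimalPeriod_eq (by omega) (by omega) (by omega)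
  have hlt : ∀ z, minimalPeriod c z < k := by
    intro z
    by_cases hz : a ≤ z ∧ z < b
    · rw [pI z hz]; omega
    · rcases lt_or_ge (z : ℕ) n with hz' | hz'
      · rw [pK z hz']; omega
      · rw [pJ z hz' hz]; omega
  have hyI : ¬ (a ≤ y ∧ y < b) := fun e => absurd e.2 (not_lt.2 hby)
  have py := pJ y (by omega) hyI
  rw [HasCycleLengths, exists_minimalPeriod_swap_mul_iff hxy.ne hlt, py]
  constructor
  · rintro ⟨⟨hs, hk⟩, -⟩
    rcases lt_or_ge (x : ℕ) n with hx | hx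
    · rw [pK x hx] at hk
      exact ⟨hx, by omega⟩
    · exfalso
      by_cases hxI : a ≤ x ∧ x < b
      · rw [pI x hxI] at hk
        omega
      · refine hs ?_
        have key : ∀ z : Fin (n + m), n ≤ (z : ℕ) → ¬ (a ≤ z ∧ z < b) → c.SameCycle b z := by
          intro z hz hzI
          have ho := sameCycle_swap_mul_cut_or hab.ne
            (h2.sameCycle (z := a) (w := b) ha (by omega) (by omega) (by omega))
            (h2.sameCycle (z := a) (w := z) ha (by omega) hz (by omega))
          refine ho.resolve_left fun hs' => hzI ?_
          have := hI.mem_of_sameCycle le_rfl (by omega) hs'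
          exact ⟨this.1, Fin.lt_def.2 (by omega)⟩
        exact (key x hx hxI).symm.trans (key y (by omega) hyI)
  · rintro ⟨hx, he⟩
    have hs : ∀ z : Fin (n + m), n ≤ (z : ℕ) → ¬ c.SameCycle x z := fun z hz e => by
      have := hK.mem_of_sameCycle (by omega) (by omega) e
      omega
    refine ⟨⟨hs y (by omega), by rw [pK x hx]; omega⟩, a, ?_⟩
    rw [minimalPeriod_swap_mul_of_not_sameCycle (hs a ha), pI a ⟨le_rfl, hab⟩]
    · omega
    · intro e
      have := hI.mem_of_sameCycle le_rfl (by omega) e.symm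
      omega

theorem swap_mul_full_cycle (h1 : RotatesInterval σ 0 n) (h2 : RotatesInterval σ n m)
    (ha : (a : ℕ) < n) (hb : n ≤ b) (z : Fin (n + m)) :
    (swap a b * σ).SameCycle y z ∧ minimalPeriod (swap a b * σ : Perm _) z = n + m := by
  have hs : ¬ σ.SameCycle a b := fun e => by
    have := h1.mem_of_sameCycle (by omega) (by omega) e
    omega
  have hs' : ¬ σ.SameCycle b a := fun e => hs e.symm
  have hjoin : (swap a b * σ).SameCycle a b := by
    nth_rw 2 [← swap_mul_iterate_join hs]
    exact sameCycle_iterate _ _ _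
  have key : ∀ w : Fin (n + m), (swap a b * σ).SameCycle a w := by
    intro w
    rcases lt_or_ge (w : ℕ) n with hw | hw
    · exact sameCycle_swap_mul_join hs (h1.sameCycle (by omega) (by omega) (by omega) (by omega))
    · refine hjoin.trans ?_
      rw [swap_comm]
      exact sameCycle_swap_mul_join hs' (h2.sameCycle hb b.2 hw w.2)
  refine ⟨(key y).symm.trans (key z), ?_⟩
  rw [← SameCycle.minimalPeriod_eq (key z), minimalPeriod_swap_mul_join hs,
    h1.minimalPeriod_eq (by omega) (by omega) (by omega), h2.minimalPeriod_eq le_rfl hb b.2]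

/-- The first transposition joins the two blocks to a single cycle. -/
theorem hasCycleLengths_iff_of_join (h1 : RotatesInterval σ 0 n) (h2 : RotatesInterval σ n m)
    (hd : n + m = k + l) (hk : 0 < k) (hl : 0 < l) (hxy : x < y) (ha : (a : ℕ) < n) (hb : n ≤ b) :
    HasCycleLengths (swap x y * (swap a b * σ)) k l ↔
      x = (swap a b * σ : Perm _)^[k] y ∨ x = (swap a b * σ : Perm _)^[l] y :=
  exists_minimalPeriod_swap_mul_full_cycle_iff hxy.ne hk hl
    (fun z => (swap_mul_full_cycle h1 h2 ha hb z).1)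
    ((swap_mul_full_cycle (y := y) h1 h2 ha hb y).2.trans hd)

theorem swap_mul_iterate_val_of_join (h2 : RotatesInterval σ n m) (ha : (a : ℕ) < n)
    (hb : n ≤ b) (hby : b ≤ y) {i : ℕ} (hi : (y : ℕ) + i < n + m) :
    ((swap a b * σ : Perm _)^[i] y : ℕ) = y + i := by
  have hby' : (b : ℕ) ≤ y := hby
  have hv : ∀ j, (y : ℕ) + j < n + m → (σ^[j] y : ℕ) = y + j := fun j hj =>
    h2.iterate_val (by omega) hj
  rw [swap_mul_iterate_of_avoid (k := i + 1) _ (by omega), hv i hi]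
  intro j hj hji
  have := hv j (by omega)
  constructor <;> intro e <;> rw [e] at this <;> omega

theorem swap_mul_iterate_lt_iff_of_join (h1 : RotatesInterval σ 0 n)
    (h2 : RotatesInterval σ n m) (ha : (a : ℕ) < n) (hb : n ≤ b) (hby : b ≤ y) {i : ℕ}
    (hi : i < n + m) : (swap a b * σ : Perm _)^[i] y < y ↔ n + m ≤ y + i := by
  constructor
  · intro h
    by_contra hlt
    have := swap_mul_iterate_val_of_join h2 ha hb hby (not_le.1 hlt)
    rw [Fin.lt_def] at h
    omega
  · intro h
    by_contra hge
    rw [not_lt, Fin.le_def] at hge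
    set w := (swap a b * σ : Perm _)^[i] y with hw
    have hp := (swap_mul_full_cycle (y := y) h1 h2 ha hb y).2
    have e : (swap a b * σ : Perm _)^[(w : ℕ) - y] y = (swap a b * σ : Perm _)^[i] y := by
      rw [← hw]
      apply Fin.ext
      rw [swap_mul_iterate_val_of_join h2 ha hb hby (by omega)]
      omega
    rw [iterate_eq_iterate_iff_of_lt_minimalPeriod (by omega) (by omega)] at e
    omega

end Cases

section Sums

theorem card_filter_fin_val (N : ℕ) (p : ℕ → Prop) [DecidablePred p] :
    (Finset.univ.filter fun x : Fin N => p x).card = ((Finset.range N).filter p).card := by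
  rw [Finset.card_filter, Finset.card_filter, Finset.sum_range]

theorem sum_range_ite_le (N p : ℕ) :
    (∑ j ∈ Finset.range N, if p ≤ j then 1 else 0) = N - p := by
  rw [← Finset.card_filter, ← Nat.card_Ico]
  congr 1
  ext j
  simp only [Finset.mem_filter, Finset.mem_range, Finset.mem_Ico]
  omega

theorem sum_range_ite_lt (N p : ℕ) :
    (∑ j ∈ Finset.range N, if j < p then 1 else 0) = min N p := by
  rw [← Finset.card_filter, ← Finset.card_range (min N p)]
  congr 1
  ext j
  simp only [Finset.mem_filter, Finset.mem_range]
  omega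

theorem sum_range_two_mul_sub (m : ℕ) : ∑ i ∈ Finset.range m, 2 * (m - i) = m * (m + 1) := by
  induction m with
  | zero => rfl
  | succ m ih =>
    rw [Finset.sum_range_succ']
    simp only [Nat.add_sub_add_right, ih, Nat.sub_zero]
    ring

/-- The number of `x` that complete `(a, b, y)` to a solution. -/
def completions (n m l a b y : ℕ) : ℕ :=
  if b < n then
    if a < b ∧ n ≤ y then
      (if b = a + l then n - l else 0) + (if b + l = a + n then n - l else 0)
    else 0
  else if b ≤ y then
    if a < n then 1 + (if n + m ≤ y + l then 1 else 0) else if b = a + l then n else 0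
  else 0

variable {n m l a b : ℕ}

theorem sum_completions_left (hl : 0 < l) (hln : l < n) (ha : a < n) :
    ∑ b ∈ Finset.range n, ∑ y ∈ Finset.range (n + m), completions n m l a b y =
      m * (n - l) * ((if a < n - l then 1 else 0) + (if a < l then 1 else 0)) := by
  have h : ∀ b ∈ Finset.range n, ∑ y ∈ Finset.range (n + m), completions n m l a b y =
      m * (n - l) * ((if a + l = b then 1 else 0) + (if a + (n - l) = b then 1 else 0)) := by
    intro b hb
    rw [Finset.mem_range] at hb
    have : ∀ y ∈ Finset.range (n + m), completions n m l a b y = (if n ≤ y then 1 else 0) *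
        ((n - l) * ((if a + l = b then 1 else 0) + (if a + (n - l) = b then 1 else 0))) := by
      intro y _
      unfold completions
      split_ifs <;> omega
    rw [Finset.sum_congr rfl this, ← Finset.sum_mul, sum_range_ite_le, Nat.add_sub_cancel_left,
      mul_assoc]
  rw [Finset.sum_congr rfl h, ← Finset.mul_sum, Finset.sum_add_distrib, Finset.sum_ite_eq,
    Finset.sum_ite_eq]
  simp only [Finset.mem_range]
  congr 3 <;> simp only [eq_iff_iff] <;> omega

theorem sum_completions_join (ha : a < n) (hb : n ≤ b) :
    ∑ y ∈ Finset.range (n + m), completions n m l a b y =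
      (n + m - b) + (n + m - max b (n + m - l)) := by
  rw [← sum_range_ite_le (n + m) b, ← sum_range_ite_le (n + m) (max b (n + m - l)),
    ← Finset.sum_add_distrib]
  refine Finset.sum_congr rfl fun y _ => ?_
  unfold completions
  split_ifs <;> omega

theorem sum_completions_right (ha : n ≤ a) :
    ∑ b ∈ Finset.range m, ∑ y ∈ Finset.range (n + m), completions n m l a (n + b) y =
      n * (n + m - (a + l)) := by
  have h : ∀ b ∈ Finset.range m, ∑ y ∈ Finset.range (n + m), completions n m l a (n + b) y =
      if a + l - n = b then n * (n + m - (a + l)) else 0 := by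
    intro b hb
    have : ∀ y ∈ Finset.range (n + m), completions n m l a (n + b) y =
        (if a + l ≤ y then 1 else 0) * (if a + l - n = b then n else 0) := by
      intro y _
      unfold completions
      split_ifs <;> omega
    rw [Finset.sum_congr rfl this, ← Finset.sum_mul, sum_range_ite_le]
    split_ifs
    · rw [mul_comm]
    · rfl
  rw [Finset.sum_congr rfl h, Finset.sum_ite_eq]
  simp only [Finset.mem_range, ite_eq_left_iff, not_lt]
  intro hm
  rw [Nat.sub_eq_zero_of_le (by omega), mul_zero]

theorem completions_eq_zero (ha : n ≤ a) (hb : b < n) (y : ℕ) :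
    completions n m l a b y = 0 := by
  unfold completions
  rw [if_pos hb, if_neg (by omega)]

theorem sum_completions (hl : 0 < l) (hln : l < n) :
    ∑ a ∈ Finset.range (n + m), ∑ b ∈ Finset.range (n + m), ∑ y ∈ Finset.range (n + m),
      completions n m l a b y = n * m * (n + m - l + 1) := by
  have hL : ∑ a ∈ Finset.range n, ∑ b ∈ Finset.range n, ∑ y ∈ Finset.range (n + m),
      completions n m l a b y = m * (n - l) * n := by
    rw [Finset.sum_congr rfl fun a ha =>
      sum_completions_left (m := m) hl hln (Finset.mem_range.1 ha), ← Finset.mul_sum,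
      Finset.sum_add_distrib, sum_range_ite_lt, sum_range_ite_lt, min_eq_right (by omega),
      min_eq_right (by omega), Nat.sub_add_cancel hln.le]
  have hA : ∑ a ∈ Finset.range n, ∑ b ∈ Finset.range m, ∑ y ∈ Finset.range (n + m),
      completions n m l a (n + b) y =
        n * ∑ b ∈ Finset.range m, ((m - b) + (n + m - max (n + b) (n + m - l))) := by
    rw [Finset.sum_congr rfl fun a ha => Finset.sum_congr rfl fun b _ =>
      sum_completions_join (m := m) (l := l) (Finset.mem_range.1 ha) (Nat.le_add_right n b),
      Finset.sum_const, Finset.card_range, smul_eq_mul]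
    simp only [Nat.add_sub_add_left]
  have hR : ∑ a ∈ Finset.range m, ∑ b ∈ Finset.range n, ∑ y ∈ Finset.range (n + m),
      completions n m l (n + a) b y = 0 :=
    Finset.sum_eq_zero fun a _ => Finset.sum_eq_zero fun b hb => Finset.sum_eq_zero fun y _ =>
      completions_eq_zero (Nat.le_add_right n a) (Finset.mem_range.1 hb) y
  have hB : ∑ a ∈ Finset.range m, ∑ b ∈ Finset.range m, ∑ y ∈ Finset.range (n + m),
      completions n m l (n + a) (n + b) y = n * ∑ a ∈ Finset.range m, (n + m - (n + a + l)) := by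
    rw [Finset.sum_congr rfl fun a _ => sum_completions_right (Nat.le_add_right n a),
      Finset.mul_sum]
  have hAB : ∑ b ∈ Finset.range m, ((m - b) + (n + m - max (n + b) (n + m - l))) +
      ∑ a ∈ Finset.range m, (n + m - (n + a + l)) = m * (m + 1) := by
    rw [← Finset.sum_add_distrib, ← sum_range_two_mul_sub]
    refine Finset.sum_congr rfl fun i hi => ?_
    rw [Finset.mem_range] at hi
    omega
  have hsplit : ∀ a, ∑ b ∈ Finset.range (n + m), ∑ y ∈ Finset.range (n + m),
      completions n m l a b y =
        ∑ b ∈ Finset.range n, ∑ y ∈ Finset.range (n + m), completions n m l a b y +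
        ∑ b ∈ Finset.range m, ∑ y ∈ Finset.range (n + m), completions n m l a (n + b) y :=
    fun a => Finset.sum_range_add _ n m
  rw [Finset.sum_congr rfl fun a _ => hsplit a, Finset.sum_range_add, Finset.sum_add_distrib,
    Finset.sum_add_distrib, hL, hA, hR, hB, zero_add, add_assoc, ← mul_add, hAB]
  obtain ⟨e, rfl⟩ := Nat.exists_eq_add_of_lt hln
  rw [show l + e + 1 + m - l = e + 1 + m by omega, show l + e + 1 - l = e + 1 by omega]
  ring

end Sums

section Count

variable {n m k l : ℕ} {σ : Perm (Fin (n + m))} {a b y : Fin (n + m)}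

open Classical in
theorem card_completions_join (h1 : RotatesInterval σ 0 n) (h2 : RotatesInterval σ n m)
    (hd : n + m = k + l) (hmk : m < k) (hl : 0 < l) (hlk : l < k)
    (ha : (a : ℕ) < n) (hb : n ≤ b) (hby : b ≤ y) :
    (Finset.univ.filter fun x : Fin (n + m) => x < y ∧ HasCycleLengths (swap x y * (swap a b * σ)) k l).card =
      1 + if n + m ≤ y + l then 1 else 0 := by
  have hby' : (b : ℕ) ≤ y := hby
  have hp := (swap_mul_full_cycle (y := y) h1 h2 ha hb y).2
  have hk' := (swap_mul_iterate_lt_iff_of_join h1 h2 ha hb hby (i := k) (by omega)).2 (by omega)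
  have hl' := swap_mul_iterate_lt_iff_of_join h1 h2 ha hb hby (i := l) (by omega)
  have hne : (swap a b * σ : Perm _)^[k] y ≠ (swap a b * σ : Perm _)^[l] y := by
    intro e
    rw [iterate_eq_iterate_iff_of_lt_minimalPeriod (by omega) (by omega)] at e
    omega
  split_ifs with h
  · refine Eq.trans ?_ (Finset.card_pair hne)
    congr 1
    ext x
    simp only [Finset.mem_filter, Finset.mem_univ, true_and, Finset.mem_insert,
      Finset.mem_singleton]
    constructor
    · rintro ⟨hx, hc⟩
      exact (hasCycleLengths_iff_of_join h1 h2 hd (by omega) hl hx ha hb).1 hc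
    · intro hx
      have hxy : x < y := by
        rcases hx with rfl | rfl
        · exact hk'
        · exact hl'.2 h
      exact ⟨hxy, (hasCycleLengths_iff_of_join h1 h2 hd (by omega) hl hxy ha hb).2 hx⟩
  · rw [add_zero, ← Finset.card_singleton ((swap a b * σ : Perm _)^[k] y)]
    congr 1
    ext x
    simp only [Finset.mem_filter, Finset.mem_univ, true_and, Finset.mem_singleton]
    constructor
    · rintro ⟨hx, hc⟩
      refine ((hasCycleLengths_iff_of_join h1 h2 hd (by omega) hl hx ha hb).1 hc).resolve_right ?_
      rintro rfl
      exact h (hl'.1 hx)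
    · rintro rfl
      exact ⟨hk', (hasCycleLengths_iff_of_join h1 h2 hd (by omega) hl hk' ha hb).2 (Or.inl rfl)⟩

open Classical in
theorem card_completions_cut_right (h1 : RotatesInterval σ 0 n) (h2 : RotatesInterval σ n m)
    (hd : n + m = k + l) (hnk : n < k) (hmk : m < k) (hab : a < b) (hby : b ≤ y) (ha : n ≤ a) :
    (Finset.univ.filter fun x : Fin (n + m) => x < y ∧ HasCycleLengths (swap x y * (swap a b * σ)) k l).card =
      if (b : ℕ) = a + l then n else 0 := by
  have hab' : (a : ℕ) < b := hab
  have hby' : (b : ℕ) ≤ y := hby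
  split_ifs with h
  · have hs := sum_range_ite_lt (n + m) n
    rw [← Finset.card_filter, ← card_filter_fin_val, min_eq_right (by omega)] at hs
    refine Eq.trans ?_ hs
    congr 1
    ext x
    simp only [Finset.mem_filter, Finset.mem_univ, true_and]
    constructor
    · rintro ⟨hx, hc⟩
      exact ((hasCycleLengths_iff_of_cut_right h1 h2 hd hnk hmk hab hx hby ha).1 hc).1
    · intro hx
      have hxy : x < y := Fin.lt_def.2 (by omega)
      exact ⟨hxy, (hasCycleLengths_iff_of_cut_right h1 h2 hd hnk hmk hab hxy hby ha).2 ⟨hx, h⟩⟩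
  · rw [Finset.card_eq_zero, Finset.filter_eq_empty_iff]
    rintro x - ⟨hx, hc⟩
    exact h ((hasCycleLengths_iff_of_cut_right h1 h2 hd hnk hmk hab hx hby ha).1 hc).2

open Classical in
theorem card_completions_cut_left (h1 : RotatesInterval σ 0 n) (h2 : RotatesInterval σ n m)
    (hd : n + m = k + l) (hnk : n < k) (hmk : m < k) (hab : a < b) (hb : (b : ℕ) < n) :
    (Finset.univ.filter fun x : Fin (n + m) => x < y ∧ HasCycleLengths (swap x y * (swap a b * σ)) k l).card =
      if n ≤ y then
        (if (b : ℕ) = a + l then n - l else 0) + (if (b : ℕ) + l = a + n then n - l else 0)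
      else 0 := by
  have hab' : (a : ℕ) < b := hab
  split_ifs with hy h h' h'
  rotate_right
  · rw [Finset.card_eq_zero, Finset.filter_eq_empty_iff]
    rintro x - ⟨hx, hc⟩
    exact hy ((hasCycleLengths_iff_of_cut_left h1 h2 hd hnk hmk hab hx hb).1 hc).1
  all_goals
    have hset : (Finset.univ.filter fun x : Fin (n + m) =>
        x < y ∧ HasCycleLengths (swap x y * (swap a b * σ)) k l) =
        Finset.univ.filter fun x : Fin (n + m) => (x : ℕ) < n ∧
          (((a : ℕ) ≤ x ∧ (x : ℕ) < b) ∧ (b : ℕ) + l = a + n ∨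
            ¬ ((a : ℕ) ≤ x ∧ (x : ℕ) < b) ∧ (b : ℕ) = a + l) := by
      ext x
      simp only [Finset.mem_filter, Finset.mem_univ, true_and]
      constructor
      · rintro ⟨hx, hc⟩
        exact ((hasCycleLengths_iff_of_cut_left h1 h2 hd hnk hmk hab hx hb).1 hc).2
      · intro hx
        have hxy : x < y := Fin.lt_def.2 (by omega)
        exact ⟨hxy, (hasCycleLengths_iff_of_cut_left h1 h2 hd hnk hmk hab hxy hb).2 ⟨hy, hx⟩⟩
    rw [hset, card_filter_fin_val (n + m) fun x => x < n ∧
          (((a : ℕ) ≤ x ∧ x < b) ∧ (b : ℕ) + l = a + n ∨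
            ¬ ((a : ℕ) ≤ x ∧ x < b) ∧ (b : ℕ) = a + l)]
    clear hset
  · trans (Finset.range n).card
    · congr 1
      ext x
      simp only [Finset.mem_filter, Finset.mem_range]
      omega
    · rw [Finset.card_range]
      omega
  · trans (Finset.range n \ Finset.Ico (a : ℕ) b).card
    · congr 1
      ext x
      simp only [Finset.mem_filter, Finset.mem_range, Finset.mem_sdiff, Finset.mem_Ico]
      omega
    · rw [Finset.card_sdiff_of_subset, Finset.card_range, Nat.card_Ico]
      · omega
      · intro x
        simp only [Finset.mem_range, Finset.mem_Ico]
        omega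
  · trans (Finset.Ico (a : ℕ) b).card
    · congr 1
      ext x
      simp only [Finset.mem_filter, Finset.mem_range, Finset.mem_Ico]
      omega
    · rw [Nat.card_Ico]
      omega
  · rw [Finset.card_eq_zero, Finset.filter_eq_empty_iff]
    intro x _ hx
    omega

open Classical in
theorem card_completions (h1 : RotatesInterval σ 0 n) (h2 : RotatesInterval σ n m)
    (hd : n + m = k + l) (hnk : n < k) (hmk : m < k) (hl : 0 < l) (hln : l < n) :
    (Finset.univ.filter fun x : Fin (n + m) => a < b ∧ x < y ∧ b ≤ y ∧
      HasCycleLengths (swap x y * (swap a b * σ)) k l).card = completions n m l a b y := by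
  by_cases hab : a < b ∧ b ≤ y
  · obtain ⟨hab, hby⟩ := hab
    have hab' : (a : ℕ) < b := hab
    have hby' : (b : ℕ) ≤ y := hby
    simp only [hab, hby, true_and]
    unfold completions
    rcases lt_or_ge (b : ℕ) n with hb | hb
    · rw [if_pos hb, card_completions_cut_left h1 h2 hd hnk hmk hab hb]
      simp only [hab', true_and]
    · rw [if_neg (by omega), if_pos hby']
      rcases lt_or_ge (a : ℕ) n with ha | ha
      · rw [if_pos ha, card_completions_join h1 h2 hd hmk hl (by omega) ha hb hby]
      · rw [if_neg (by omega), card_completions_cut_right h1 h2 hd hnk hmk hab hby ha]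
  · have hab' : ¬ ((a : ℕ) < b ∧ (b : ℕ) ≤ y) := hab
    rw [Finset.card_eq_zero.2 (Finset.filter_eq_empty_iff.2 fun x _ hx => hab ⟨hx.1, hx.2.2.1⟩)]
    unfold completions
    split_ifs <;> omega

/-- The number of solutions, as quadruples `(a, b, y, x)` with `τ₁ = (a b)` and `τ₂ = (x y)`. -/
theorem card_quadruples (h1 : RotatesInterval σ 0 n) (h2 : RotatesInterval σ n m)
    (hd : n + m = k + l) (hnk : n < k) (hmk : m < k) (hl : 0 < l) (hln : l < n) :
    Nat.card {q : Fin (n + m) × Fin (n + m) × Fin (n + m) × Fin (n + m) //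
      q.1 < q.2.1 ∧ q.2.2.2 < q.2.2.1 ∧ q.2.1 ≤ q.2.2.1 ∧
        HasCycleLengths (swap q.2.2.2 q.2.2.1 * (swap q.1 q.2.1 * σ)) k l} =
      n * m * (k + 1) := by
  classical
  rw [Nat.card_eq_fintype_card, Fintype.card_subtype, Finset.card_filter,
    Fintype.sum_prod_type]
  simp only [Fintype.sum_prod_type]
  simp only [← Finset.card_filter, card_completions h1 h2 hd hnk hmk hl hln]
  have hs := sum_completions (m := m) hl hln
  simp only [Finset.sum_range] at hs
  rw [hs, show n + m - l = k by omega]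

end Count

theorem permTop_swap {d : ℕ} {a b : Fin d} (hab : a < b) : permTop (swap a b) = b := by
  have hab' : (a : ℕ) < b := hab
  rw [permTop, Perm.support_swap hab.ne, Finset.sup_insert, Finset.sup_singleton]
  exact max_eq_right hab'.le

theorem swap_injective_of_lt {d : ℕ} {a b a' b' : Fin d} (h : a < b) (h' : a' < b')
    (e : swap a b = swap a' b') : a = a' ∧ b = b' := by
  have hb : b = b' := by
    apply Fin.ext
    rw [← permTop_swap h, ← permTop_swap h', e]
  subst hb
  refine ⟨?_, rfl⟩
  have := congrArg (fun f : Perm (Fin d) => f b) e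
  simpa using this

theorem exists_swap_of_isSwap {d : ℕ} {τ : Perm (Fin d)} (h : τ.IsSwap) :
    ∃ a b, a < b ∧ τ = swap a b := by
  obtain ⟨a, b, hab, rfl⟩ := h
  rcases lt_or_gt_of_ne hab with hl | hl
  · exact ⟨a, b, hl, rfl⟩
  · exact ⟨b, a, hl, swap_comm a b⟩

theorem monCond_two_iff {d : ℕ} (τ : Fin 2 → Perm (Fin d)) :
    MonCond 2 0 τ ↔ permTop (τ 0) ≤ permTop (τ 1) := by
  constructor
  · intro h
    exact (h 0 1 rfl).1 (by decide)
  · intro h i j hij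
    obtain rfl : i = 0 := by omega
    obtain rfl : j = 1 := by omega
    refine ⟨fun _ => h, fun h1 => ?_⟩
    simp at h1

theorem hasCycleLengths_inv {d k l : ℕ} (π : Perm (Fin d)) :
    HasCycleLengths π⁻¹ k l ↔ HasCycleLengths π k l := by
  simp only [HasCycleLengths, minimalPeriod_inv]

/-- When the two lengths differ and exhaust the points, the listing of orbits exists if and only
if there are cycles of these lengths, and it is unique. -/
theorem isOrbitListing_iff {d k l : ℕ} (hd : d = k + l) (hkl : k ≠ l) (π : Perm (Fin d))
    (B : Fin 2 → Set (Fin d)) :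
    IsOrbitListing π ![k, l] B ↔
      HasCycleLengths π k l ∧ B = fun j => {z | minimalPeriod π z = ![k, l] j} := by
  have hinj : Injective ![k, l] := by
    intro i j hij
    fin_cases i <;> fin_cases j <;> simp_all
  constructor
  · rintro ⟨horb, -, hcov, hcard⟩
    have hmem : ∀ j z, z ∈ B j → minimalPeriod π z = ![k, l] j := by
      intro j z hz
      obtain ⟨x, hx⟩ := horb j
      rw [← hcard j, hx, ncard_sameCycle]
      rw [hx] at hz
      exact (SameCycle.minimalPeriod_eq hz).symm
    have hex : ∀ j, ∃ z, minimalPeriod π z = ![k, l] j := by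
      intro j
      obtain ⟨x, hx⟩ := horb j
      exact ⟨x, hmem j x (by rw [hx]; exact Perm.SameCycle.refl π x)⟩
    refine ⟨⟨hex 0, hex 1⟩, ?_⟩
    funext j
    ext z
    refine ⟨hmem j z, fun hz => ?_⟩
    obtain ⟨i, hi⟩ := hcov z
    have : ![k, l] i = ![k, l] j := (hmem i z hi).symm.trans hz
    rwa [← hinj this]
  · rintro ⟨⟨⟨u, hu⟩, ⟨v, hv⟩⟩, rfl⟩
    have hdisj : Disjoint {z | π.SameCycle u z} {z | π.SameCycle v z} := by
      rw [Set.disjoint_left]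
      intro z h1 h2
      have e1 := SameCycle.minimalPeriod_eq h1
      have e2 := SameCycle.minimalPeriod_eq h2
      exact hkl (by rw [← hu, ← hv, e1, e2])
    have hunion : {z | π.SameCycle u z} ∪ {z | π.SameCycle v z} = Set.univ := by
      rw [Set.eq_univ_iff_ncard, Set.ncard_union_eq hdisj, ncard_sameCycle, ncard_sameCycle,
        hu, hv, Nat.card_eq_fintype_card, Fintype.card_fin, hd]
    have hcov : ∀ z, π.SameCycle u z ∨ π.SameCycle v z := fun z => by
      have : z ∈ {z | π.SameCycle u z} ∪ {z | π.SameCycle v z} := hunion ▸ Set.mem_univ z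
      exact this
    have hset : ∀ j, {z | minimalPeriod π z = ![k, l] j} = {z | π.SameCycle (![u, v] j) z} := by
      intro j
      ext z
      fin_cases j
      · refine ⟨fun hz => (hcov z).resolve_right fun h => hkl ?_, fun hz => ?_⟩
        · exact (hz : minimalPeriod π z = k).symm.trans
            ((SameCycle.minimalPeriod_eq h).symm.trans hv)
        · exact (SameCycle.minimalPeriod_eq hz).symm.trans hu
      · refine ⟨fun hz => (hcov z).resolve_left fun h => hkl ?_, fun hz => ?_⟩
        · exact hu.symm.trans ((SameCycle.minimalPeriod_eq h).trans hz)
        · exact (SameCycle.minimalPeriod_eq hz).symm.trans hv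
    have hper : ∀ j, minimalPeriod π (![u, v] j) = ![k, l] j := by
      intro j
      fin_cases j
      · exact hu
      · exact hv
    refine ⟨fun j => ⟨_, hset j⟩, fun i j hij => ?_, fun z => ?_, fun j => ?_⟩
    · have : ![u, v] i ∈ {z | minimalPeriod π z = ![k, l] j} := by
        rw [← show {z | minimalPeriod π z = ![k, l] i} = {z | minimalPeriod π z = ![k, l] j} from hij]
        exact hper i
      exact hinj ((hper i).symm.trans this)
    · rcases hcov z with h | h
      · exact ⟨0, (SameCycle.minimalPeriod_eq h).symm.trans hu⟩
      · exact ⟨1, (SameCycle.minimalPeriod_eq h).symm.trans hv⟩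
    · show Set.ncard {z | minimalPeriod π z = ![k, l] j} = _
      rw [hset, ncard_sameCycle, hper]

theorem exists_mem_closure_of_sameCycle {α : Type*} {S : Set (Perm α)} {π : Perm α} (hπ : π ∈ S)
    {x y : α} (h : π.SameCycle x y) : ∃ g ∈ Subgroup.closure S, g x = y := by
  obtain ⟨i, hi⟩ := h
  exact ⟨π ^ i, Subgroup.zpow_mem _ (Subgroup.subset_closure hπ) i, hi⟩

/-- A cycle longer than both blocks makes the generated group transitive. -/
theorem transitive_of_long_cycle {n m k : ℕ} {σ π : Perm (Fin (n + m))}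
    (h1 : RotatesInterval σ 0 n) (h2 : RotatesInterval σ n m) (hn : n < k) (hm : m < k)
    {u : Fin (n + m)} (hu : minimalPeriod π u = k) {S : Set (Perm (Fin (n + m)))} (hσ : σ ∈ S)
    (hπ : π ∈ S) (x y : Fin (n + m)) : ∃ g ∈ Subgroup.closure S, g x = y := by
  have hout : ∀ lo len, lo + len ≤ n + m → len < k →
      ∃ z, π.SameCycle u z ∧ ¬ (lo ≤ (z : ℕ) ∧ (z : ℕ) < lo + len) := by
    intro lo len hle hlen
    by_contra hno
    push Not at hno
    have hsub : {z | π.SameCycle u z} ⊆ ((Finset.Ico lo (lo + len)).attachFin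
        (fun i hi => by rw [Finset.mem_Ico] at hi; omega) : Finset (Fin (n + m))) := by
      intro z hz
      rw [Finset.mem_coe, Finset.mem_attachFin, Finset.mem_Ico]
      exact hno z hz
    have := Set.ncard_le_ncard hsub
    rw [ncard_sameCycle, hu, Set.ncard_coe_finset, Finset.card_attachFin, Nat.card_Ico] at this
    omega
  obtain ⟨q, hq, hqn⟩ := hout 0 n (by omega) hn
  obtain ⟨p, hp, hpn⟩ := hout n m le_rfl hm
  have hto : ∀ z, ∃ g ∈ Subgroup.closure S, g p = z := by
    intro z
    rcases lt_or_ge (z : ℕ) n with hz | hz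
    · exact exists_mem_closure_of_sameCycle hσ
        (h1.sameCycle (by omega) (by omega) (by omega) (by omega))
    · obtain ⟨g, hg, hgq⟩ := exists_mem_closure_of_sameCycle hπ (hp.symm.trans hq)
      obtain ⟨g', hg', hgz⟩ := exists_mem_closure_of_sameCycle hσ
        (h2.sameCycle (z := q) (w := z) (by omega) q.2 hz z.2)
      exact ⟨g' * g, mul_mem hg' hg, by rw [Perm.mul_apply, hgq, hgz]⟩
  obtain ⟨g, hg, rfl⟩ := hto x
  obtain ⟨g', hg', rfl⟩ := hto y
  exact ⟨g' * g⁻¹, mul_mem hg' (inv_mem hg), by simp⟩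

theorem card_factorizations {n m k l : ℕ} {σ : Perm (Fin (n + m))}
    (h1 : RotatesInterval σ 0 n) (h2 : RotatesInterval σ n m)
    (hd : n + m = k + l) (hnk : n < k) (hmk : m < k) (hl : 0 < l) (hln : l < n) :
    Nat.card {t : (Fin 2 → Perm (Fin (n + m))) × Perm (Fin (n + m)) ×
        (Fin 2 → Set (Fin (n + m))) //
      (∀ i, (t.1 i).IsSwap) ∧ MonCond 2 0 t.1 ∧
      t.2.1 * (List.ofFn t.1).reverse.prod * σ = 1 ∧
      (∀ x y : Fin (n + m), ∃ g ∈ Subgroup.closure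
        ({σ, t.2.1} ∪ Set.range t.1 : Set (Perm (Fin (n + m)))), g x = y) ∧
      IsOrbitListing t.2.1 ![k, l] t.2.2} = n * m * (k + 1) := by
  rw [← card_quadruples h1 h2 hd hnk hmk hl hln]
  symm
  have hprod : ∀ τ : Fin 2 → Perm (Fin (n + m)), (List.ofFn τ).reverse.prod = τ 1 * τ 0 := by
    intro τ
    simp [List.ofFn_succ]
  refine Nat.card_eq_of_bijective (fun q => ⟨(![swap q.1.1 q.1.2.1, swap q.1.2.2.2 q.1.2.2.1],
    (swap q.1.2.2.2 q.1.2.2.1 * (swap q.1.1 q.1.2.1 * σ))⁻¹,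
    fun j => {z | minimalPeriod
      ((swap q.1.2.2.2 q.1.2.2.1 * (swap q.1.1 q.1.2.1 * σ))⁻¹ : Perm _) z = ![k, l] j}), ?_⟩) ⟨?_, ?_⟩
  · obtain ⟨⟨a, b, y, x⟩, hab, hxy, hby, hc⟩ := q
    dsimp only at hab hxy hby hc ⊢
    have hc' := (hasCycleLengths_inv _).2 hc
    refine ⟨?_, ?_, ?_, ?_, ?_⟩
    · intro i
      fin_cases i
      · exact ⟨a, b, hab.ne, rfl⟩
      · exact ⟨x, y, hxy.ne, rfl⟩
    · rw [monCond_two_iff]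
      show permTop (swap a b) ≤ permTop (swap x y)
      rw [permTop_swap hab, permTop_swap hxy]
      exact hby
    · rw [hprod]
      show (swap x y * (swap a b * σ))⁻¹ * (swap x y * swap a b) * σ = 1
      group
    · obtain ⟨u, hu⟩ := hc'.1
      exact transitive_of_long_cycle h1 h2 hnk hmk hu (Or.inl (Or.inl rfl))
        (Or.inl (Or.inr rfl))
    · rw [isOrbitListing_iff hd (by omega)]
      exact ⟨hc', rfl⟩
  · rintro ⟨⟨a, b, y, x⟩, hab, hxy, hq⟩ ⟨⟨a', b', y', x'⟩, hab', hxy', hq'⟩ e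
    have e1 := congrArg (fun t => t.1.1) e
    have e10 : swap a b = swap a' b' := congrFun e1 0
    have e11 : swap x y = swap x' y' := congrFun e1 1
    obtain ⟨rfl, rfl⟩ := swap_injective_of_lt hab hab' e10
    obtain ⟨rfl, rfl⟩ := swap_injective_of_lt hxy hxy' e11
    rfl
  · rintro ⟨⟨τ, σ₂, B⟩, hsw, hmon, hmul, htr, hB⟩
    dsimp only at hsw hmon hmul htr hB
    obtain ⟨a, b, hab, h0⟩ := exists_swap_of_isSwap (hsw 0)
    obtain ⟨x, y, hxy, h1'⟩ := exists_swap_of_isSwap (hsw 1)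
    rw [monCond_two_iff, h0, h1', permTop_swap hab, permTop_swap hxy] at hmon
    rw [hprod, h0, h1', mul_assoc, mul_assoc] at hmul
    have hσ₂ : σ₂ = (swap x y * (swap a b * σ))⁻¹ := eq_inv_of_mul_eq_one_left hmul
    rw [isOrbitListing_iff hd (by omega)] at hB
    have hτ : τ = ![swap a b, swap x y] := by
      funext i
      fin_cases i
      · exact h0
      · exact h1'
    subst hσ₂
    refine ⟨⟨(a, b, y, x), hab, hxy, hmon, (hasCycleLengths_inv _).1 hB.1⟩, ?_⟩
    apply Subtype.ext
    simp only [hτ, hB.2]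

theorem coe_finRotate_eq_ite {N : ℕ} (i : Fin N) :
    (finRotate N i : ℕ) = if (i : ℕ) + 1 = N then 0 else (i : ℕ) + 1 := by
  obtain ⟨N, rfl⟩ : ∃ M, N = M + 1 := ⟨N - 1, by have := i.2; omega⟩
  rw [coe_finRotate]
  have : i = Fin.last N ↔ (i : ℕ) + 1 = N + 1 := by
    rw [Fin.ext_iff, Fin.val_last]
    omega
  simp only [this]

theorem blockPerm_finSigmaFinEquiv {m : ℕ} (μ : Fin m → ℕ) (i : Fin m) (j : Fin (μ i)) :
    blockPerm μ (finSigmaFinEquiv ⟨i, j⟩) = finSigmaFinEquiv ⟨i, finRotate (μ i) j⟩ := by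
  simp [blockPerm, Equiv.permCongr_apply]

/-- `σ_μ` rotates the block number `i`. -/
theorem rotatesInterval_blockPerm {m : ℕ} (μ : Fin m → ℕ) (i : Fin m) :
    RotatesInterval (blockPerm μ) (∑ j : Fin i, μ (Fin.castLE i.2.le j)) (μ i) := by
  intro z hz1 hz2
  have hz : z = finSigmaFinEquiv
      ⟨i, ⟨z - ∑ j : Fin i, μ (Fin.castLE i.2.le j), by omega⟩⟩ := by
    apply Fin.ext
    rw [finSigmaFinEquiv_apply]
    dsimp only
    omega
  rw [hz, blockPerm_finSigmaFinEquiv, finSigmaFinEquiv_apply, finSigmaFinEquiv_apply]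
  dsimp only
  rw [coe_finRotate_eq_ite]
  dsimp only
  split_ifs <;> omega

theorem card_factorizations_of_eq {n m k l d : ℕ} (hnm : d = n + m) {σ : Perm (Fin d)}
    (h1 : RotatesInterval σ 0 n) (h2 : RotatesInterval σ n m)
    (hd : n + m = k + l) (hnk : n < k) (hmk : m < k) (hl : 0 < l) (hln : l < n) :
    Nat.card {t : (Fin 2 → Perm (Fin d)) × Perm (Fin d) × (Fin 2 → Set (Fin d)) //
      (∀ i, (t.1 i).IsSwap) ∧ MonCond 2 0 t.1 ∧
      t.2.1 * (List.ofFn t.1).reverse.prod * σ = 1 ∧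
      (∀ x y : Fin d, ∃ g ∈ Subgroup.closure
        ({σ, t.2.1} ∪ Set.range t.1 : Set (Perm (Fin d))), g x = y) ∧
      IsOrbitListing t.2.1 ![k, l] t.2.2} = n * m * (k + 1) := by
  subst hnm
  exact card_factorizations h1 h2 hd hnk hmk hl hln

/-- In the chamber `μ₁ < ν₁, ν₂ < μ₁, μ₂ < ν₁, ν₂ < μ₂`, the monotone count
`M_{2,0,0;(μ₁,μ₂),(ν₁,ν₂)}` (two transpositions with `top τ₁ ≤ top τ₂`) equals
`μ₁·μ₂·(ν₁+1)`. -/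
theorem strictly_monotone_count_chamberTwo
    (μ₁ μ₂ ν₁ ν₂ : ℕ)
    (hμ₁ : 0 < μ₁) (hμ₂ : 0 < μ₂) (hν₁ : 0 < ν₁) (hν₂ : 0 < ν₂)
    (hd : μ₁ + μ₂ = ν₁ + ν₂)
    (c1 : μ₁ < ν₁) (c2 : ν₂ < μ₁) (c3 : μ₂ < ν₁) (c4 : ν₂ < μ₂) :
    Mcount 2 0 0 ![μ₁, μ₂] ![ν₁, ν₂] = μ₁ * μ₂ * (ν₁ + 1) := by
  have h1 := rotatesInterval_blockPerm ![μ₁, μ₂] 0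
  have h2 := rotatesInterval_blockPerm ![μ₁, μ₂] 1
  have e1 : ∑ j : Fin ((1 : Fin 2) : ℕ), ![μ₁, μ₂] (Fin.castLE (1 : Fin 2).2.le j) = μ₁ :=
    Fin.sum_univ_one _
  rw [e1] at h2
  exact card_factorizations_of_eq (Fin.sum_univ_two _) h1 h2 hd c1 c3 hν₂ c2
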